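/- There exists a constant C > 0 with the following property. Let t ≥ 1 and let g : ℤ → ℂ be a sequence with ∑_{n∈ℤ} n²|g_n|² < ∞ whose Fourier transform ĝ(ξ) = (2π)^{-1/2} ∑_{n∈ℤ} g_n e^{inξ} satisfies ĝ(π/2) = 0 and ĝ(−π/2) = 0. Define w_n(t) = (2π)^{-1/2} ∫_{−π}^{π} e^{2it cos ξ} ĝ(ξ) e^{−inξ} dξ. Then |w_n(t)| ≤ C · t^{−1/2} · (∑_{n∈ℤ} n²|g_n|²)^{1/2} for all n ∈ ℤ. -/

import Mathlib

/-- The Fourier transform of a sequence `g : ℤ → ℂ`: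
`ĝ(ξ) = (2π)^{-1/2} ∑_{n∈ℤ} g_n e^{inξ}`. -/
noncomputable def discFT (g : ℤ → ℂ) (ξ : ℝ) : ℂ :=
  (Real.sqrt (2 * Real.pi) : ℂ)⁻¹ *
    ∑' n : ℤ, g n * Complex.exp (Complex.I * (n : ℂ) * (ξ : ℂ))

/-- The linear Ablowitz–Ladik propagator applied to `g` at time `t`:
`w_n(t) = (2π)^{-1/2} ∫_{−π}^{π} e^{2it cos ξ} ĝ(ξ) e^{−inξ} dξ`. -/
noncomputable def alProp (g : ℤ → ℂ) (t : ℝ) (n : ℤ) : ℂ :=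
  (Real.sqrt (2 * Real.pi) : ℂ)⁻¹ *
    ∫ ξ in (-Real.pi)..Real.pi,
      Complex.exp (((2 * t * Real.cos ξ : ℝ) : ℂ) * Complex.I) * discFT g ξ *
        Complex.exp (-(Complex.I * (n : ℂ) * (ξ : ℂ)))


lemma aux_G (y y0 : ℝ) (hy : 0 ≤ y) (hy0 : 0 ≤ y0) :
    (1+y+y0)*√(1+y+y0)/((y^2-y0^2)^2+(1+y0)) ≤
      24*(√(1+y0)/(1+(1+y0)*(y-y0)^2) + 1/(1+(y-y0)^2)) := by
  have hs : 0 ≤ √(1+y0) := Real.sqrt_nonneg _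
  have hfac : (y^2-y0^2)^2 = (y+y0)^2*(y-y0)^2 := by ring
  by_cases hz : y - y0 ≤ 1 + y0
  · have h1 : (1+y+y0)*√(1+y+y0)/((y^2-y0^2)^2+(1+y0)) ≤ 24*(√(1+y0)/(1+(1+y0)*(y-y0)^2)) := by
      have hp : 1+y+y0 ≤ 3*(1+y0) := by linarith
      have hsq : √(1+y+y0) ≤ 2*√(1+y0) := by
        rw [Real.sqrt_le_left (by positivity), mul_pow, Real.sq_sqrt (by positivity)]
        linarith
      have hN : (1+y+y0)*√(1+y+y0) ≤ 3*(1+y0)*(2*√(1+y0)) := by gcongr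
      have hD : (1+y0)*(1+(1+y0)*(y-y0)^2) ≤ 4*((y^2-y0^2)^2+(1+y0)) := by
        rw [hfac]
        by_cases h : (1+y0) ≤ 2*(y+y0)
        · have : (1+y0)^2 ≤ (2*(y+y0))^2 := by gcongr
          nlinarith [mul_le_mul_of_nonneg_right this (sq_nonneg (y-y0))]
        · have h2 : y0 < 1 := by linarith
          have h3 : (y-y0)^2 ≤ 1 := by
            rw [sq_le_one_iff_abs_le_one, abs_le]; constructor <;> linarith
          have h4 : (1+y0)*(y-y0)^2 ≤ 2*1 := by gcongr; linarith
          have := mul_le_mul_of_nonneg_left h4 (show 0 ≤ 1+y0 by linarith)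
          nlinarith [mul_nonneg (sq_nonneg (y+y0)) (sq_nonneg (y-y0))]
      rw [← mul_div_assoc, div_le_div_iff₀ (by positivity) (by positivity)]
      calc _ ≤ 3*(1+y0)*(2*√(1+y0)) * (1+(1+y0)*(y-y0)^2) := by gcongr
        _ = 6*√(1+y0) * ((1+y0)*(1+(1+y0)*(y-y0)^2)) := by ring
        _ ≤ 6*√(1+y0) * (4*((y^2-y0^2)^2+(1+y0))) := by gcongr
        _ = _ := by ring
    have : 0 ≤ 1/(1+(y-y0)^2) := by positivity
    linarith
  · push Not at hz
    have h1 : (1+y+y0)*√(1+y+y0)/((y^2-y0^2)^2+(1+y0)) ≤ 24*(1/(1+(y-y0)^2)) := by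
      have hp : 1+y+y0 ≤ 2*y := by linarith
      have hsq : √(1+y+y0) ≤ 2*y := by
        rw [Real.sqrt_le_left (by positivity)]
        nlinarith
      have hN : (1+y+y0)*√(1+y+y0) ≤ 2*y*(2*y) := by gcongr
      have hz1 : 1 ≤ (y-y0)^2 := by nlinarith
      rw [← mul_div_assoc, div_le_div_iff₀ (by positivity) (by positivity), hfac]
      have hyy : y^2*(y-y0)^2 ≤ (y+y0)^2*(y-y0)^2 := by gcongr; linarith
      calc _ ≤ 2*y*(2*y) * ((y-y0)^2+(y-y0)^2) := by gcongr
        _ = 8*(y^2*(y-y0)^2) := by ring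
        _ ≤ _ := by nlinarith [mul_nonneg (sq_nonneg y) (sq_nonneg (y-y0))]
    have : 0 ≤ √(1+y0)/(1+(1+y0)*(y-y0)^2) := by positivity
    linarith

lemma aux_Gint (τ δ s : ℝ) (hτ : 1 ≤ τ) (hs : 1 ≤ s) :
    ∫ x in (0:ℝ)..Real.pi, (√s/(1+s*(τ*x-τ*δ)^2) + 1/(1+(τ*x-τ*δ)^2)) ≤ 2*Real.pi/τ := by
  have hd : ∀ x : ℝ, HasDerivAt (fun x => (Real.arctan (√s*(τ*x-τ*δ)) + Real.arctan (τ*x-τ*δ))/τ)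
      (√s/(1+s*(τ*x-τ*δ)^2) + 1/(1+(τ*x-τ*δ)^2)) x := by
    intro x
    have h0 : HasDerivAt (fun x => τ*x-τ*δ) τ x := by
      simpa using ((hasDerivAt_id x).const_mul τ).sub_const (τ*δ)
    have h1 := ((h0.const_mul (√s)).arctan.add h0.arctan).div_const τ
    refine h1.congr_deriv ?_
    rw [mul_pow, Real.sq_sqrt (by linarith)]
    field_simp
  rw [intervalIntegral.integral_eq_sub_of_hasDerivAt (fun x _ => hd x)]
  · rw [← sub_div]
    gcongr
    linarith [Real.arctan_lt_pi_div_two (√s*(τ*Real.pi-τ*δ)), Real.arctan_lt_pi_div_two (τ*Real.pi-τ*δ),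
      Real.neg_pi_div_two_lt_arctan (√s*(τ*0-τ*δ)), Real.neg_pi_div_two_lt_arctan (τ*0-τ*δ)]
  · apply Continuous.intervalIntegrable
    have h1 : ∀ x, 1+s*(τ*x-τ*δ)^2 ≠ 0 := fun x => by positivity
    have h2 : ∀ x, 1+(τ*x-τ*δ)^2 ≠ 0 := fun x => by positivity
    fun_prop (disch := assumption)

lemma aux_sin (u : ℝ) (h0 : 0 ≤ u) (h1 : u ≤ 3*Real.pi/4) : u/(2*Real.pi) ≤ Real.sin u := by
  have hpi := Real.pi_pos
  have e : Real.sin u = 2*Real.sin (u/2)*Real.cos (u/2) := by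
    rw [← Real.sin_two_mul]; ring_nf
  have hs : 2/Real.pi*(u/2) ≤ Real.sin (u/2) := Real.mul_le_sin (by linarith) (by linarith)
  have hc : 1/4 ≤ Real.cos (u/2) := by
    have : 2/Real.pi*(Real.pi/2-u/2) ≤ Real.sin (Real.pi/2-u/2) :=
      Real.mul_le_sin (by linarith) (by linarith)
    rw [Real.sin_pi_div_two_sub] at this
    refine le_trans ?_ this
    rw [div_mul_eq_mul_div, le_div_iff₀ hpi]; linarith
  rw [e]
  calc u/(2*Real.pi) = 2*(2/Real.pi*(u/2))*(1/4) := by field_simp; norm_num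
    _ ≤ _ := by gcongr
                exact mul_nonneg zero_le_two (le_trans (by positivity) hs)

lemma aux_cos (x δ : ℝ) (hx : 0 ≤ x) (hx' : x ≤ Real.pi) (hδ : 0 ≤ δ) (hδ' : δ ≤ Real.pi/2) :
    |x^2-δ^2|/20 ≤ |Real.cos x - Real.cos δ| := by
  have hpi := Real.pi_pos
  have hpi2 : Real.pi^2 ≤ 10 := by nlinarith [Real.pi_lt_d2]
  rw [Real.cos_sub_cos, abs_mul, abs_mul]
  have h1 := aux_sin ((x+δ)/2) (by linarith) (by linarith)
  have h2 : 2/Real.pi*(|x-δ|/2) ≤ |Real.sin ((x-δ)/2)| := by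
    have := Real.mul_abs_le_abs_sin (x := (x-δ)/2) (by rw [abs_le]; constructor <;> linarith)
    rwa [abs_div, abs_two] at this
  have h3 : |Real.sin ((x+δ)/2)| = Real.sin ((x+δ)/2) := abs_of_nonneg (le_trans (by positivity) h1)
  rw [h3]
  have : |x^2-δ^2| = (x+δ)*|x-δ| := by
    rw [sq_sub_sq, abs_mul, abs_of_nonneg (by positivity : 0 ≤ x+δ)]
  rw [this]
  calc _ ≤ 2*((x+δ)/2/(2*Real.pi))*(2/Real.pi*(|x-δ|/2)) := by
        have : 2*((x+δ)/2/(2*Real.pi))*(2/Real.pi*(|x-δ|/2)) = (x+δ)*|x-δ|/(2*Real.pi^2) := by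
          field_simp
        rw [this]; gcongr; linarith
    _ ≤ _ := by
        rw [abs_neg, abs_two]
        gcongr
        exact mul_nonneg zero_le_two (le_trans (by positivity) h1)

lemma aux_CS (a b : ℝ) (hab : a ≤ b) (f g : ℝ → ℝ) (hf : Continuous f) (hg : Continuous g)
    (hf0 : ∀ x, 0 ≤ f x) (hg0 : ∀ x, 0 ≤ g x) :
    ∫ x in a..b, f x * g x ≤ √(∫ x in a..b, f x^2) * √(∫ x in a..b, g x^2) := by
  simp only [intervalIntegral.integral_of_le hab]
  have key : ∀ f : ℝ → ℝ, Continuous f → MeasureTheory.MemLp f (ENNReal.ofReal 2)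
      (MeasureTheory.volume.restrict (Set.Ioc a b)) := by
    intro f hf
    have : MeasureTheory.MemLp f (ENNReal.ofReal 2)
      (MeasureTheory.volume.restrict (Set.Icc a b)) := by
      obtain ⟨C, hC⟩ := isCompact_Icc.exists_bound_of_continuousOn (s := Set.Icc a b) hf.continuousOn
      apply MeasureTheory.MemLp.of_bound hf.aestronglyMeasurable C
      filter_upwards [MeasureTheory.ae_restrict_mem measurableSet_Icc] with x hx using hC x hx
    exact this.mono_measure (MeasureTheory.Measure.restrict_mono Set.Ioc_subset_Icc_self le_rfl)
  have := MeasureTheory.integral_mul_le_Lp_mul_Lq_of_nonneg (μ := MeasureTheory.volume.restrict (Set.Ioc a b))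
    (p := 2) (q := 2) Real.HolderConjugate.two_two
    (Filter.Eventually.of_forall hf0) (Filter.Eventually.of_forall hg0) (key f hf) (key g hg)
  simpa [Real.sqrt_eq_rpow] using this

/-- Pointwise bounds, in the rescaled variables. -/
lemma aux_pt (τ δ x q : ℝ) (hτ : 1 ≤ τ) (hδ : 0 ≤ δ) (hx : 0 ≤ x)
    (hq : τ^3*|x^2-δ^2|/10 ≤ |q|) :
    (q/(q^2+τ^2*(1+τ*δ)))^2 ≤ 2400/τ^2 * (√(1+τ*δ)/(1+(1+τ*δ)*(τ*x-τ*δ)^2) + 1/(1+(τ*x-τ*δ)^2)) ∧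
    √x * ((τ^2*(1+τ*δ) + 2*τ^3*x)/(q^2+τ^2*(1+τ*δ))) ≤
      4800/√τ * (√(1+τ*δ)/(1+(1+τ*δ)*(τ*x-τ*δ)^2) + 1/(1+(τ*x-τ*δ)^2)) := by
  have hτ0 : 0 < τ := by linarith
  have hG := aux_G (τ*x) (τ*δ) (by positivity) (by positivity)
  set G := √(1+τ*δ)/(1+(1+τ*δ)*(τ*x-τ*δ)^2) + 1/(1+(τ*x-τ*δ)^2) with hGdef
  set D0 := ((τ*x)^2-(τ*δ)^2)^2+(1+τ*δ) with hD0
  set p := 1+τ*x+τ*δ with hp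
  set s := 1+τ*δ with hs
  have hs1 : 1 ≤ s := by rw [hs]; nlinarith [mul_nonneg hτ0.le hδ]
  have hp1 : 1 ≤ p := by rw [hp]; nlinarith [mul_nonneg hτ0.le hδ, mul_nonneg hτ0.le hx]
  have hD0p : 0 < D0 := by positivity
  have hD : τ^2/100*D0 ≤ q^2+τ^2*s := by
    have h1 : (τ^3*|x^2-δ^2|/10)^2 ≤ |q|^2 := by gcongr
    rw [sq_abs, div_pow, mul_pow, sq_abs] at h1
    have h2 : τ^2*D0 = (τ^3)^2*(x^2-δ^2)^2 + τ^2*s := by rw [hD0]; ring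
    have : 0 ≤ τ^2*s := by positivity
    nlinarith
  have hDp : 0 < q^2+τ^2*s := by positivity
  have hsp : 1 ≤ √p := by rw [Real.one_le_sqrt]; exact hp1
  constructor
  · calc (q/(q^2+τ^2*s))^2 ≤ 1/(q^2+τ^2*s) := by
          rw [div_pow, div_le_div_iff₀ (by positivity) hDp]
          have : 0 ≤ τ^2*s := by positivity
          nlinarith
      _ ≤ 1/(τ^2/100*D0) := by gcongr
      _ = 100/τ^2*(1*1/D0) := by field_simp
      _ ≤ 100/τ^2*(p*√p/D0) := by gcongr
      _ ≤ 100/τ^2*(24*G) := by gcongr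
      _ = _ := by ring
  · have hsx : √x ≤ √p/√τ := by
      rw [le_div_iff₀ (by positivity), ← Real.sqrt_mul hx]
      apply Real.sqrt_le_sqrt
      rw [hp]; nlinarith [mul_nonneg hτ0.le hδ]
    have hN : τ^2*s+2*τ^3*x ≤ 2*τ^2*p := by
      rw [hs, hp]
      have : 0 ≤ τ^2*(1+τ*δ) := by positivity
      nlinarith
    calc _ ≤ √p/√τ * ((2*τ^2*p)/(τ^2/100*D0)) := by gcongr
      _ = 200/√τ * (p*√p/D0) := by field_simp; norm_num
      _ ≤ 200/√τ * (24*G) := by gcongr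
      _ = _ := by ring

open Complex in
lemma aux_core (τ ν : ℝ) (hτ : 1 ≤ τ) (hν : ν ≤ 0) (F F' : ℝ → ℂ)
    (hF : ∀ x, HasDerivAt F (F' x) x) (hF' : Continuous F') :
    ‖∫ x in (0:ℝ)..Real.pi, cexp (((2*τ^3*Real.sin x + ν*x : ℝ) : ℂ) * I) * F x‖ ≤
      32000 / (τ*√τ) * √(∫ x in (0:ℝ)..Real.pi, ‖F' x‖^2) +
        (2 + Real.pi*(1+2*τ^3)) * (‖F 0‖ + ‖F Real.pi‖) := by
  have hτ0 : 0 < τ := by linarith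
  have hpi := Real.pi_pos
  have hFc : Continuous F := continuous_iff_continuousAt.2 fun x => (hF x).continuousAt
  obtain ⟨δ, hδ, hδ', hq⟩ : ∃ δ : ℝ, 0 ≤ δ ∧ δ ≤ Real.pi/2 ∧ ∀ x, 0 ≤ x → x ≤ Real.pi →
      τ^3*|x^2-δ^2|/10 ≤ |2*τ^3*Real.cos x + ν| := by
    have hm0 : 0 ≤ -ν/(2*τ^3) := div_nonneg (by linarith) (by positivity)
    have hν' : ν = -(2*τ^3)*(-ν/(2*τ^3)) := by field_simp
    set m := -ν/(2*τ^3)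
    refine ⟨Real.arccos (min 1 m), Real.arccos_nonneg _,
      Real.arccos_le_pi_div_two.2 (le_min zero_le_one hm0), fun x hx hx' => ?_⟩
    have h := aux_cos x (Real.arccos (min 1 m)) hx hx' (Real.arccos_nonneg _)
      (Real.arccos_le_pi_div_two.2 (le_min zero_le_one hm0))
    have hc : Real.cos (Real.arccos (min 1 m)) = min 1 m :=
      Real.cos_arccos (by have := le_min zero_le_one hm0; linarith) (min_le_left _ _)
    rw [hc] at h
    have h2 : |Real.cos x - min 1 m| ≤ |Real.cos x - m| := by
      rcases le_total m 1 with h1 | h1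
      · rw [min_eq_right h1]
      · rw [min_eq_left h1]
        have := Real.cos_le_one x
        rw [abs_of_nonpos (by linarith), abs_of_nonpos (by linarith)]; linarith
    have h3 : 2*τ^3*Real.cos x + ν = 2*τ^3*(Real.cos x - m) := by rw [hν']; ring
    rw [h3, abs_mul, abs_of_pos (by positivity : 0 < 2*τ^3)]
    have h4 := mul_le_mul_of_nonneg_left (h.trans h2) (by positivity : 0 ≤ 2*τ^3)
    refine le_trans (le_of_eq ?_) h4
    ring
  set M := τ^2*(1+τ*δ) with hM
  have hM1 : 1 ≤ M := by
    rw [hM]; nlinarith [mul_nonneg hτ0.le hδ, mul_nonneg (sq_nonneg τ) (mul_nonneg hτ0.le hδ)]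
  set q : ℝ → ℝ := fun x => 2*τ^3*Real.cos x + ν with hqdef
  set q' : ℝ → ℝ := fun x => -(2*τ^3*Real.sin x) with hq'def
  have hqd : ∀ x, HasDerivAt q (q' x) x := fun x => by
    refine (((Real.hasDerivAt_cos x).const_mul (2*τ^3)).add_const ν).congr_deriv ?_
    simp only [hq'def]; ring
  have hqc : Continuous q := by fun_prop
  have hq'c : Continuous q' := by fun_prop
  set D : ℝ → ℝ := fun x => q x^2+M with hDdef
  have hDp : ∀ x, 1 ≤ D x := fun x => by have := sq_nonneg (q x); simp only [hDdef]; linarith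
  have hD0 : ∀ x, D x ≠ 0 := fun x => by linarith [hDp x]
  have hDc : Continuous D := by fun_prop
  set h : ℝ → ℝ := fun x => q x / D x with hh
  set h' : ℝ → ℝ := fun x => q' x*(M - q x^2)/D x^2 with hh'
  have hhd : ∀ x, HasDerivAt h (h' x) x := fun x => by
    have := (hqd x).div (((hqd x).pow 2).add_const M) (hD0 x)
    refine this.congr_deriv ?_
    simp only [hh', hDdef]
    congr 1
    simp; ring
  have hhc : Continuous h := by fun_prop (disch := assumption)
  have hD0' : ∀ x, D x^2 ≠ 0 := fun x => pow_ne_zero 2 (hD0 x)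
  have hh'c : Continuous h' := by fun_prop (disch := assumption)
  set θ : ℝ → ℝ := fun x => 2*τ^3*Real.sin x + ν*x with hθ
  have hθd : ∀ x, HasDerivAt θ (q x) x := fun x => by
    refine (((Real.hasDerivAt_sin x).const_mul (2*τ^3)).add
      ((hasDerivAt_id x).const_mul ν)).congr_deriv ?_
    simp only [hqdef, mul_one]
  have hθc : Continuous θ := by fun_prop
  set E : ℝ → ℂ := fun x => cexp ((θ x : ℂ) * I) with hE
  have hEn : ∀ x, ‖E x‖ = 1 := fun x => Complex.norm_exp_ofReal_mul_I _
  have hEd : ∀ x, HasDerivAt E (E x * (q x * I)) x := fun x =>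
    ((hθd x).ofReal_comp.mul_const I).cexp
  have hEc : Continuous E := by fun_prop
  set r : ℝ → ℂ := fun x => (M / D x : ℝ) + (h' x : ℝ) * I with hr
  have hrc : Continuous r := by
    have : Continuous fun x => M / D x := by fun_prop (disch := assumption)
    fun_prop
  set P : ℝ → ℂ := fun x => -I * ((h x : ℂ) * E x) with hP
  have hPd : ∀ x, HasDerivAt P (E x - r x * E x) x := fun x => by
    have := ((hhd x).ofReal_comp.mul (hEd x)).const_mul (-I)
    refine this.congr_deriv ?_
    have e1 : (M / D x : ℝ) = 1 - h x * q x := by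
      simp only [hh]; field_simp [hD0 x]; simp only [hDdef]; ring
    simp only [hr, e1]
    push_cast
    linear_combination (-(h x : ℂ) * q x * E x) * I_sq
  have hPc : Continuous P := by fun_prop
  -- integration by parts
  have ibp := intervalIntegral.integral_mul_deriv_eq_deriv_mul (a := 0) (b := Real.pi)
    (u := F) (v := P) (u' := F') (v' := fun x => E x - r x * E x)
    (fun x _ => hF x) (fun x _ => hPd x) (hF'.intervalIntegrable _ _)
    (Continuous.intervalIntegrable (by fun_prop) _ _)
  have split : ∫ x in (0:ℝ)..Real.pi, E x * F x =
      (F Real.pi * P Real.pi - F 0 * P 0 - ∫ x in (0:ℝ)..Real.pi, F' x * P x) +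
        ∫ x in (0:ℝ)..Real.pi, r x * E x * F x := by
    rw [← ibp, ← intervalIntegral.integral_add]
    · congr 1; ext x; ring
    · exact Continuous.intervalIntegrable (by fun_prop) _ _
    · exact Continuous.intervalIntegrable (by fun_prop) _ _
  have hPn : ∀ x, ‖P x‖ = |h x| := fun x => by simp [hP, hEn]
  have hh1 : ∀ x, |h x| ≤ 1 := fun x => by
    simp only [hh]
    rw [abs_div, abs_of_pos (by linarith [hDp x] : 0 < D x), div_le_one (by linarith [hDp x])]
    simp only [hDdef]
    nlinarith [sq_abs (q x), sq_nonneg (|q x| - 1)]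
  have hrn : ∀ x, ‖r x‖ ≤ (M + |q' x|)/D x := fun x => by
    have hDx : 0 < D x := by linarith [hDp x]
    have e1 : |h' x| ≤ |q' x|/D x := by
      simp only [hh']
      rw [abs_div, abs_mul, abs_of_pos (by positivity : 0 < D x^2), div_le_div_iff₀ (by positivity) hDx]
      have : |M - q x^2| ≤ D x := by
        simp only [hDdef]
        rw [abs_le]; constructor <;> nlinarith [sq_nonneg (q x)]
      calc _ ≤ |q' x| * D x * D x := by gcongr
        _ = _ := by ring
    calc ‖r x‖ ≤ ‖((M / D x : ℝ) : ℂ)‖ + ‖(h' x : ℂ) * I‖ := norm_add_le _ _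
      _ = M / D x + |h' x| := by
        rw [norm_mul, norm_I, mul_one, norm_real, norm_real, Real.norm_eq_abs, Real.norm_eq_abs,
          abs_of_pos (by positivity : 0 < M / D x)]
      _ ≤ M / D x + |q' x|/D x := by gcongr
      _ = _ := by ring
  set S := √(∫ x in (0:ℝ)..Real.pi, ‖F' x‖^2) with hS
  set G : ℝ → ℝ := fun x => √(1+τ*δ)/(1+(1+τ*δ)*(τ*x-τ*δ)^2) + 1/(1+(τ*x-τ*δ)^2) with hG
  have hGc : Continuous G := by
    have h1 : ∀ x, 1+(1+τ*δ)*(τ*x-τ*δ)^2 ≠ 0 := fun x => by positivity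
    have h2 : ∀ x, 1+(τ*x-τ*δ)^2 ≠ 0 := fun x => by positivity
    fun_prop (disch := assumption)
  have hGi : ∫ x in (0:ℝ)..Real.pi, G x ≤ 2*Real.pi/τ :=
    aux_Gint τ δ (1+τ*δ) hτ (by nlinarith [mul_nonneg hτ0.le hδ])
  have hpi3 : Real.pi ≤ 3.15 := Real.pi_lt_d2.le
  -- first: the L2 norm of P
  have T1 : ‖∫ x in (0:ℝ)..Real.pi, F' x * P x‖ ≤ 200/(τ*√τ) * S := by
    have a1 : ∫ x in (0:ℝ)..Real.pi, |h x|^2 ≤ 2400/τ^2*(2*Real.pi/τ) := by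
      calc _ ≤ ∫ x in (0:ℝ)..Real.pi, 2400/τ^2 * G x := by
            apply intervalIntegral.integral_mono_on hpi.le
              (Continuous.intervalIntegrable (by fun_prop) _ _)
              (Continuous.intervalIntegrable (by fun_prop) _ _)
            intro x hx
            rw [sq_abs]
            exact (aux_pt τ δ x (q x) hτ hδ hx.1 (hq x hx.1 hx.2)).1
        _ = 2400/τ^2 * ∫ x in (0:ℝ)..Real.pi, G x := intervalIntegral.integral_const_mul _ _
        _ ≤ _ := by gcongr
    have a2 : √(∫ x in (0:ℝ)..Real.pi, |h x|^2) ≤ 200/(τ*√τ) := by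
      rw [Real.sqrt_le_left (by positivity)]
      refine a1.trans ?_
      rw [div_pow, mul_pow, Real.sq_sqrt hτ0.le, div_mul_div_comm]
      have : τ^2*τ > 0 := by positivity
      gcongr
      linarith
    calc _ ≤ ∫ x in (0:ℝ)..Real.pi, ‖F' x * P x‖ :=
          intervalIntegral.norm_integral_le_integral_norm hpi.le
      _ = ∫ x in (0:ℝ)..Real.pi, |h x| * ‖F' x‖ := by
          congr 1; ext x; rw [norm_mul, hPn]; ring
      _ ≤ √(∫ x in (0:ℝ)..Real.pi, |h x|^2) * S :=
          aux_CS 0 Real.pi hpi.le (fun x => |h x|) (fun x => ‖F' x‖) (by fun_prop) (by fun_prop)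
            (fun x => abs_nonneg _) (fun x => norm_nonneg _)
      _ ≤ _ := by gcongr
  have hFx : ∀ x, 0 ≤ x → x ≤ Real.pi → ‖F x‖ ≤ ‖F 0‖ + √x * S := by
    intro x hx hx'
    have e1 : ∫ y in (0:ℝ)..x, F' y = F x - F 0 :=
      intervalIntegral.integral_eq_sub_of_hasDerivAt (fun y _ => hF y) (hF'.intervalIntegrable _ _)
    have e2 : ‖F x - F 0‖ ≤ √x * S := by
      rw [← e1]
      calc _ ≤ ∫ y in (0:ℝ)..x, ‖F' y‖ := intervalIntegral.norm_integral_le_integral_norm hx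
        _ = ∫ y in (0:ℝ)..x, (1:ℝ) * ‖F' y‖ := by simp
        _ ≤ √(∫ y in (0:ℝ)..x, (1:ℝ)^2) * √(∫ y in (0:ℝ)..x, ‖F' y‖^2) :=
          aux_CS 0 x hx (fun x => 1) (fun x => ‖F' x‖) (by fun_prop) (by fun_prop)
            (fun x => zero_le_one) (fun x => norm_nonneg _)
        _ ≤ √x * S := by
          have b1 : ∫ y in (0:ℝ)..x, (1:ℝ)^2 = x := by simp
          rw [b1]
          gcongr
          apply Real.sqrt_le_sqrt
          apply intervalIntegral.integral_mono_interval le_rfl hx hx'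
          · exact Filter.Eventually.of_forall fun y => by positivity
          · exact Continuous.intervalIntegrable (by fun_prop) _ _
    calc ‖F x‖ = ‖F 0 + (F x - F 0)‖ := by congr 1; ring
      _ ≤ _ := (norm_add_le _ _).trans (by gcongr)
  have T2 : ‖∫ x in (0:ℝ)..Real.pi, r x * E x * F x‖ ≤
      Real.pi*(1+2*τ^3)*‖F 0‖ + 31500/(τ*√τ)*S := by
    calc _ ≤ ∫ x in (0:ℝ)..Real.pi, ‖r x * E x * F x‖ :=
          intervalIntegral.norm_integral_le_integral_norm hpi.le
      _ ≤ ∫ x in (0:ℝ)..Real.pi, ((1+2*τ^3)*‖F 0‖ + 4800/√τ*S*G x) := by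
          apply intervalIntegral.integral_mono_on hpi.le
            (Continuous.intervalIntegrable (by fun_prop) _ _)
            (Continuous.intervalIntegrable (by fun_prop) _ _)
          intro x hx
          have hDx : 0 < D x := by linarith [hDp x]
          rw [norm_mul, norm_mul, hEn, mul_one]
          have c1 : ‖r x‖ ≤ 1+2*τ^3 := by
            refine (hrn x).trans ?_
            have d1 : |q' x| ≤ 2*τ^3 := by
              simp only [hq'def, abs_neg, abs_mul]
              rw [abs_two, abs_of_pos (by positivity : 0 < τ^3)]
              have := Real.abs_sin_le_one x
              have : 0 < 2*τ^3 := by positivity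
              nlinarith
            rw [div_le_iff₀ hDx]
            have d2 : M ≤ D x := by simp only [hDdef]; nlinarith [sq_nonneg (q x)]
            have : 0 < 2*τ^3 := by positivity
            nlinarith [hDp x]
          have c2 : √x * ‖r x‖ ≤ 4800/√τ * G x := by
            refine le_trans ?_ (aux_pt τ δ x (q x) hτ hδ hx.1 (hq x hx.1 hx.2)).2
            gcongr
            refine (hrn x).trans ?_
            have d1 : |q' x| ≤ 2*τ^3*x := by
              simp only [hq'def, abs_neg, abs_mul]
              rw [abs_two, abs_of_pos (by positivity : 0 < τ^3)]
              have : |Real.sin x| ≤ x := by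
                rw [abs_of_nonneg (Real.sin_nonneg_of_nonneg_of_le_pi hx.1 hx.2)]
                exact Real.sin_le hx.1
              gcongr
            simp only [hDdef]
            gcongr
          have hS0 : 0 ≤ S := Real.sqrt_nonneg _
          calc ‖r x‖ * ‖F x‖ ≤ ‖r x‖ * (‖F 0‖ + √x * S) := by gcongr; exact hFx x hx.1 hx.2
            _ = ‖r x‖ * ‖F 0‖ + (√x * ‖r x‖) * S := by ring
            _ ≤ (1+2*τ^3)*‖F 0‖ + (4800/√τ * G x) * S := by gcongr
            _ = _ := by ring
      _ = Real.pi*(1+2*τ^3)*‖F 0‖ + 4800/√τ*S*∫ x in (0:ℝ)..Real.pi, G x := by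
          rw [intervalIntegral.integral_add (Continuous.intervalIntegrable (by fun_prop) _ _)
            (Continuous.intervalIntegrable (by fun_prop) _ _), intervalIntegral.integral_const_mul]
          simp; ring
      _ ≤ Real.pi*(1+2*τ^3)*‖F 0‖ + 4800/√τ*S*(2*Real.pi/τ) := by gcongr
      _ = Real.pi*(1+2*τ^3)*‖F 0‖ + (9600*Real.pi)/(τ*√τ)*S := by
          congr 1; field_simp; ring
      _ ≤ _ := by gcongr; linarith
  rw [split]
  have hS0 : 0 ≤ S := Real.sqrt_nonneg _
  have B1 : ‖F Real.pi * P Real.pi‖ ≤ ‖F Real.pi‖ := by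
    rw [norm_mul, hPn]; exact mul_le_of_le_one_right (norm_nonneg _) (hh1 _)
  have B0 : ‖F 0 * P 0‖ ≤ ‖F 0‖ := by
    rw [norm_mul, hPn]; exact mul_le_of_le_one_right (norm_nonneg _) (hh1 _)
  have N1 := norm_add_le (F Real.pi * P Real.pi - F 0 * P 0 - ∫ x in (0:ℝ)..Real.pi, F' x * P x)
    (∫ x in (0:ℝ)..Real.pi, r x * E x * F x)
  have N2 := norm_sub_le (F Real.pi * P Real.pi - F 0 * P 0) (∫ x in (0:ℝ)..Real.pi, F' x * P x)
  have N3 := norm_sub_le (F Real.pi * P Real.pi) (F 0 * P 0)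
  have X : 200/(τ*√τ) * S + 31500/(τ*√τ)*S ≤ 32000/(τ*√τ)*S := by
    rw [← add_mul, ← add_div]; gcongr; norm_num
  have Y : 0 ≤ Real.pi*(1+2*τ^3)*‖F Real.pi‖ := by positivity
  nlinarith [norm_nonneg (F 0), norm_nonneg (F Real.pi)]

open Complex in
lemma aux_core2 (τ ν : ℝ) (hτ : 1 ≤ τ) (F F' : ℝ → ℂ)
    (hF : ∀ x, HasDerivAt F (F' x) x) (hF' : Continuous F') :
    ‖∫ x in (0:ℝ)..Real.pi, cexp (((2*τ^3*Real.sin x + ν*x : ℝ) : ℂ) * I) * F x‖ ≤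
      32000 / (τ*√τ) * √(∫ x in (0:ℝ)..Real.pi, ‖F' x‖^2) +
        (2 + Real.pi*(1+2*τ^3)) * (‖F 0‖ + ‖F Real.pi‖) := by
  rcases le_total ν 0 with hν | hν
  · exact aux_core τ ν hτ hν F F' hF hF'
  have h := aux_core τ (-ν) hτ (by linarith) (fun x => F (Real.pi - x)) (fun x => -F' (Real.pi - x))
    (fun x => by
      have h1 : HasDerivAt (fun x : ℝ => Real.pi - x) (-1) x := by
        simpa using (hasDerivAt_id x).const_sub Real.pi
      exact ((hF (Real.pi - x)).scomp x h1).congr_deriv (by simp)) (by fun_prop)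
  have e1 : ∫ x in (0:ℝ)..Real.pi, ‖-F' (Real.pi - x)‖^2 = ∫ x in (0:ℝ)..Real.pi, ‖F' x‖^2 := by
    have := intervalIntegral.integral_comp_sub_left (a := 0) (b := Real.pi)
      (fun x => ‖F' x‖^2) Real.pi
    simpa using this
  have e2 : ∫ x in (0:ℝ)..Real.pi, cexp (((2*τ^3*Real.sin x + ν*x : ℝ) : ℂ) * I) * F x =
      cexp ((ν*Real.pi : ℝ) * I) * ∫ x in (0:ℝ)..Real.pi,
        cexp (((2*τ^3*Real.sin x + (-ν)*x : ℝ) : ℂ) * I) * F (Real.pi - x) := by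
    have := intervalIntegral.integral_comp_sub_left (a := 0) (b := Real.pi)
      (fun x => cexp (((2*τ^3*Real.sin x + ν*x : ℝ) : ℂ) * I) * F x) Real.pi
    simp only [sub_self, sub_zero] at this
    rw [← this, ← intervalIntegral.integral_const_mul]
    congr 1; ext x
    rw [Real.sin_pi_sub, ← mul_assoc, ← Complex.exp_add]
    congr 2
    push_cast; ring
  rw [e2, norm_mul, Complex.norm_exp_ofReal_mul_I, one_mul]
  rw [e1] at h
  simp only [sub_zero, sub_self] at h
  rwa [add_comm ‖F 0‖]

open Complex in
lemma aux_core3 (τ ν : ℝ) (hτ : 1 ≤ τ) (F F' : ℝ → ℂ)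
    (hF : ∀ x, HasDerivAt F (F' x) x) (hF' : Continuous F') :
    ‖∫ x in (0:ℝ)..Real.pi, cexp (((-(2*τ^3*Real.sin x) + ν*x : ℝ) : ℂ) * I) * F x‖ ≤
      32000 / (τ*√τ) * √(∫ x in (0:ℝ)..Real.pi, ‖F' x‖^2) +
        (2 + Real.pi*(1+2*τ^3)) * (‖F 0‖ + ‖F Real.pi‖) := by
  have h := aux_core2 τ (-ν) hτ (fun x => (starRingEnd ℂ) (F x)) (fun x => (starRingEnd ℂ) (F' x))
    (fun x => (hF x).star) (Complex.continuous_conj.comp hF')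
  have e2 : ∫ x in (0:ℝ)..Real.pi, cexp (((2*τ^3*Real.sin x + (-ν)*x : ℝ) : ℂ) * I) *
        (starRingEnd ℂ) (F x) = (starRingEnd ℂ) (∫ x in (0:ℝ)..Real.pi,
        cexp (((-(2*τ^3*Real.sin x) + ν*x : ℝ) : ℂ) * I) * F x) := by
    rw [intervalIntegral.integral_of_le Real.pi_pos.le, intervalIntegral.integral_of_le Real.pi_pos.le,
      ← integral_conj]
    congr 1; ext x
    rw [map_mul, ← Complex.exp_conj, map_mul, conj_I, conj_ofReal]
    congr 2
    push_cast; ring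
  rw [e2] at h
  simpa using h

open Complex in
lemma aux_per (τ : ℝ) (n : ℤ) (hτ : 1 ≤ τ) (F F' : ℝ → ℂ) (Q : ℝ)
    (hF : ∀ x, HasDerivAt F (F' x) x) (hF' : Continuous F') (hper : Function.Periodic F (2*Real.pi))
    (hQ : ∫ x in (-(3*Real.pi/2))..(Real.pi/2), ‖F' x‖^2 ≤ Q) :
    ‖∫ ξ in (-Real.pi)..Real.pi, cexp (((2*τ^3*Real.cos ξ : ℝ) : ℂ) * I) * F ξ *
        cexp (-(I * (n : ℂ) * (ξ : ℂ)))‖ ≤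
      64000 / (τ*√τ) * √Q +
        2 * (2 + Real.pi*(1+2*τ^3)) * (‖F (Real.pi/2)‖ + ‖F (-(Real.pi/2))‖) := by
  have hpi := Real.pi_pos
  have hFc : Continuous F := continuous_iff_continuousAt.2 fun x => (hF x).continuousAt
  set H : ℝ → ℂ := fun ξ => cexp (((2*τ^3*Real.cos ξ : ℝ) : ℂ) * I) * F ξ *
        cexp (-(I * (n : ℂ) * (ξ : ℂ))) with hH
  have hHc : Continuous H := by fun_prop
  have hHp : Function.Periodic H (2*Real.pi) := by
    intro x
    simp only [hH, Real.cos_add_two_pi, hper x]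
    congr 1
    rw [Complex.exp_eq_exp_iff_exists_int]
    refine ⟨-n, ?_⟩
    push_cast; ring
  have e0 : ∫ ξ in (-Real.pi)..Real.pi, H ξ =
      (∫ ξ in (-(3*Real.pi/2))..(-(Real.pi/2)), H ξ) + ∫ ξ in (-(Real.pi/2))..(Real.pi/2), H ξ := by
    rw [intervalIntegral.integral_add_adjacent_intervals (hHc.intervalIntegrable _ _)
      (hHc.intervalIntegrable _ _)]
    have := hHp.intervalIntegral_add_eq (-Real.pi) (-(3*Real.pi/2))
    convert this using 2 <;> ring
  have hder : ∀ c x : ℝ, HasDerivAt (fun x => F (c - x)) (-F' (c - x)) x := fun c x => by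
    have h1 : HasDerivAt (fun x : ℝ => c - x) (-1) x := by
      simpa using (hasDerivAt_id x).const_sub c
    exact ((hF (c - x)).scomp x h1).congr_deriv (by simp)
  have A1 : ‖∫ ξ in (-(Real.pi/2))..(Real.pi/2), H ξ‖ ≤ 32000 / (τ*√τ) * √Q +
        (2 + Real.pi*(1+2*τ^3)) * (‖F (Real.pi/2)‖ + ‖F (-(Real.pi/2))‖) := by
    have h := aux_core2 τ n hτ (fun x => F (Real.pi/2 - x)) (fun x => -F' (Real.pi/2 - x))
      (hder _) (by fun_prop)
    have e1 : ∫ x in (0:ℝ)..Real.pi, ‖-F' (Real.pi/2 - x)‖^2 ≤ Q := by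
      have := intervalIntegral.integral_comp_sub_left (a := 0) (b := Real.pi)
        (fun x => ‖F' x‖^2) (Real.pi/2)
      simp only [norm_neg]
      rw [this]
      refine le_trans ?_ hQ
      apply intervalIntegral.integral_mono_interval (by linarith) (by linarith) (by linarith)
      · exact Filter.Eventually.of_forall fun y => by positivity
      · exact Continuous.intervalIntegrable (by fun_prop) _ _
    have e2 : ∫ ξ in (-(Real.pi/2))..(Real.pi/2), H ξ = cexp ((-(n*(Real.pi/2)) : ℝ) * I) *
        ∫ x in (0:ℝ)..Real.pi, cexp (((2*τ^3*Real.sin x + n*x : ℝ) : ℂ) * I) * F (Real.pi/2 - x) := by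
      have := intervalIntegral.integral_comp_sub_left (a := 0) (b := Real.pi) H (Real.pi/2)
      rw [show Real.pi/2 - Real.pi = -(Real.pi/2) by ring, sub_zero] at this
      rw [← this, ← intervalIntegral.integral_const_mul]
      congr 1; ext x
      simp only [hH, Real.cos_pi_div_two_sub]
      rw [mul_right_comm, ← Complex.exp_add, ← mul_assoc, ← Complex.exp_add]
      congr 2
      push_cast; ring
    rw [e2, norm_mul, Complex.norm_exp_ofReal_mul_I, one_mul]
    refine h.trans ?_
    simp only [sub_zero]
    rw [show Real.pi/2 - Real.pi = -(Real.pi/2) by ring]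
    gcongr
  have A2 : ‖∫ ξ in (-(3*Real.pi/2))..(-(Real.pi/2)), H ξ‖ ≤ 32000 / (τ*√τ) * √Q +
        (2 + Real.pi*(1+2*τ^3)) * (‖F (Real.pi/2)‖ + ‖F (-(Real.pi/2))‖) := by
    have h := aux_core3 τ n hτ (fun x => F (-(Real.pi/2) - x)) (fun x => -F' (-(Real.pi/2) - x))
      (hder _) (by fun_prop)
    have e1 : ∫ x in (0:ℝ)..Real.pi, ‖-F' (-(Real.pi/2) - x)‖^2 ≤ Q := by
      have := intervalIntegral.integral_comp_sub_left (a := 0) (b := Real.pi)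
        (fun x => ‖F' x‖^2) (-(Real.pi/2))
      simp only [norm_neg]
      rw [this]
      refine le_trans ?_ hQ
      apply intervalIntegral.integral_mono_interval (by linarith) (by linarith) (by linarith)
      · exact Filter.Eventually.of_forall fun y => by positivity
      · exact Continuous.intervalIntegrable (by fun_prop) _ _
    have e2 : ∫ ξ in (-(3*Real.pi/2))..(-(Real.pi/2)), H ξ = cexp ((n*(Real.pi/2) : ℝ) * I) *
        ∫ x in (0:ℝ)..Real.pi, cexp (((-(2*τ^3*Real.sin x) + n*x : ℝ) : ℂ) * I) *
          F (-(Real.pi/2) - x) := by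
      have := intervalIntegral.integral_comp_sub_left (a := 0) (b := Real.pi) H (-(Real.pi/2))
      rw [show -(Real.pi/2) - Real.pi = -(3*Real.pi/2) by ring, sub_zero] at this
      rw [← this, ← intervalIntegral.integral_const_mul]
      congr 1; ext x
      have hc : Real.cos (-(Real.pi/2) - x) = -Real.sin x := by
        rw [← Real.cos_neg, ← Real.cos_add_pi_div_two]; congr 1; ring
      simp only [hH, hc]
      rw [mul_right_comm, ← Complex.exp_add, ← mul_assoc, ← Complex.exp_add]
      congr 2
      push_cast; ring
    rw [e2, norm_mul, Complex.norm_exp_ofReal_mul_I, one_mul]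
    refine h.trans ?_
    have hp : F (-(Real.pi/2) - Real.pi) = F (Real.pi/2) := by
      rw [← hper]; congr 1; ring
    simp only [sub_zero]
    rw [hp, add_comm ‖F (-(Real.pi/2))‖]
    gcongr
  rw [e0]
  refine (norm_add_le _ _).trans ((add_le_add A2 A1).trans (le_of_eq ?_))
  ring

open Complex in
lemma aux_orth (m : ℤ) (a : ℝ) : ∫ x in a..(a+2*Real.pi), cexp (I * (m:ℂ) * (x:ℂ)) =
    if m = 0 then (2*Real.pi : ℂ) else 0 := by
  split_ifs with hm
  · simp [hm]
  · have hc : I * (m:ℂ) ≠ 0 := mul_ne_zero I_ne_zero (by exact_mod_cast hm)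
    rw [integral_exp_mul_complex hc, div_eq_zero_iff]
    left
    rw [sub_eq_zero, Complex.exp_eq_exp_iff_exists_int]
    exact ⟨m, by push_cast; ring⟩

open Complex in
lemma aux_parseval (s : Finset ℤ) (b : ℤ → ℂ) (a : ℝ) :
    ∫ x in a..(a+2*Real.pi), ‖∑ k ∈ s, b k * cexp (I * (k:ℂ) * (x:ℂ))‖^2 =
      2*Real.pi * ∑ k ∈ s, ‖b k‖^2 := by
  have : ((∫ x in a..(a+2*Real.pi), ‖∑ k ∈ s, b k * cexp (I * (k:ℂ) * (x:ℂ))‖^2 : ℝ) : ℂ) =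
      ((2*Real.pi * ∑ k ∈ s, ‖b k‖^2 : ℝ) : ℂ) := by
    rw [← intervalIntegral.integral_ofReal]
    have e : ∀ x : ℝ, ((‖∑ k ∈ s, b k * cexp (I * (k:ℂ) * (x:ℂ))‖^2 : ℝ) : ℂ) =
        ∑ k ∈ s, ∑ l ∈ s, b k * (starRingEnd ℂ) (b l) * cexp (I * ((k-l : ℤ):ℂ) * (x:ℂ)) := by
      intro x
      rw [ofReal_pow, ← Complex.mul_conj', map_sum, Finset.sum_mul_sum]
      refine Finset.sum_congr rfl fun k _ => Finset.sum_congr rfl fun l _ => ?_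
      rw [map_mul, ← Complex.exp_conj, mul_mul_mul_comm, ← Complex.exp_add]
      congr 2
      simp only [map_mul, conj_I, conj_ofReal, map_intCast]
      push_cast; ring
    simp only [e]
    rw [intervalIntegral.integral_finsetSum
      (fun k _ => Continuous.intervalIntegrable (by fun_prop) _ _)]
    push_cast
    rw [Finset.mul_sum]
    refine Finset.sum_congr rfl fun k hk => ?_
    rw [intervalIntegral.integral_finsetSum
      (fun k _ => Continuous.intervalIntegrable (by fun_prop) _ _)]
    simp only [intervalIntegral.integral_const_mul]
    rw [Finset.sum_eq_single k]
    · have := aux_orth (k-k) a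
      push_cast at this ⊢
      rw [this, Complex.mul_conj']; simp; ring
    · intro l _ hl
      have := aux_orth (k-l) a
      push_cast at this
      rw [this, if_neg (by rw [sub_eq_zero]; exact hl.symm), mul_zero]
    · exact fun h => absurd hk h
  exact_mod_cast this

open Complex in
lemma aux_trig (τ : ℝ) (n : ℤ) (hτ : 1 ≤ τ) (g : ℤ → ℂ) (s : Finset ℤ) :
    ‖∫ ξ in (-Real.pi)..Real.pi, cexp (((2*τ^3*Real.cos ξ : ℝ) : ℂ) * I) *
        (∑ k ∈ s, g k * cexp (I * (k:ℂ) * (ξ:ℂ))) *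
        cexp (-(I * (n : ℂ) * (ξ : ℂ)))‖ ≤
      64000 / (τ*√τ) * √(2*Real.pi * ∑ k ∈ s, (k:ℝ)^2*‖g k‖^2) +
        2 * (2 + Real.pi*(1+2*τ^3)) *
        (‖∑ k ∈ s, g k * cexp (I * (k:ℂ) * ((Real.pi/2 : ℝ):ℂ))‖ +
          ‖∑ k ∈ s, g k * cexp (I * (k:ℂ) * ((-(Real.pi/2) : ℝ):ℂ))‖) := by
  refine aux_per τ n hτ (fun ξ => ∑ k ∈ s, g k * cexp (I * (k:ℂ) * (ξ:ℂ)))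
    (fun ξ => ∑ k ∈ s, (g k * (I * k)) * cexp (I * (k:ℂ) * (ξ:ℂ))) _ ?_ (by fun_prop) ?_ ?_
  · intro x
    refine HasDerivAt.fun_sum fun k _ => ?_
    have h1 : HasDerivAt (fun x : ℝ => I * (k:ℂ) * (x:ℂ)) (I * k) x := by
      simpa using (hasDerivAt_id x).ofReal_comp.const_mul (I * (k:ℂ))
    refine (h1.cexp.const_mul (g k)).congr_deriv ?_
    ring
  · intro x
    refine Finset.sum_congr rfl fun k _ => ?_
    congr 1
    rw [Complex.exp_eq_exp_iff_exists_int]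
    exact ⟨k, by push_cast; ring⟩
  · have := aux_parseval s (fun k => g k * (I * k)) (-(3*Real.pi/2))
    rw [show -(3*Real.pi/2) + 2*Real.pi = Real.pi/2 by ring] at this
    rw [this]
    refine le_of_eq ?_
    congr 1
    refine Finset.sum_congr rfl fun k _ => ?_
    rw [norm_mul, norm_mul, norm_I, one_mul, mul_pow, mul_comm]
    congr 1
    rw [show (k:ℂ) = ((k:ℝ):ℂ) by push_cast; rfl, norm_real, Real.norm_eq_abs, sq_abs]

lemma aux_summable (g : ℤ → ℂ) (h : Summable (fun n : ℤ => (n : ℝ) ^ 2 * ‖g n‖ ^ 2)) :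
    Summable (fun n => ‖g n‖) := by
  have h2 : Summable (fun n : ℤ => 1 / (n:ℝ)^2) := Real.summable_one_div_int_pow.2 (by norm_num)
  have h3 : Summable (fun n : ℤ => if n = 0 then ‖g 0‖ else 0) := (hasSum_ite_eq 0 ‖g 0‖).summable
  refine Summable.of_nonneg_of_le (fun n => norm_nonneg _) (fun n => ?_) ((h.add h2).add h3)
  by_cases hn : n = 0
  · simp [hn]
  · have hn' : (n:ℝ) ≠ 0 := by exact_mod_cast hn
    rw [if_neg hn, add_zero]
    have e : (n:ℝ)^2*‖g n‖^2 + 1/(n:ℝ)^2 = (|(n:ℝ)| * ‖g n‖ - 1/|(n:ℝ)|)^2 + 2*‖g n‖ := by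
      have : |(n:ℝ)| ≠ 0 := abs_ne_zero.2 hn'
      rw [← sq_abs (n:ℝ)]; field_simp; ring
    rw [e]
    nlinarith [norm_nonneg (g n), sq_nonneg (|(n:ℝ)| * ‖g n‖ - 1/|(n:ℝ)|)]

/-- Improved dispersive decay when the Fourier transform vanishes at the
degenerate frequencies `±π/2`: `‖w(t)‖_{ℓ^∞} ≤ C t^{−1/2} ‖n g_n‖_{ℓ²}`. -/
theorem alProp_decay_vanishing_at_degenerate :
    ∃ C : ℝ, 0 < C ∧ ∀ t : ℝ, 1 ≤ t → ∀ g : ℤ → ℂ,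
      Summable (fun n : ℤ => (n : ℝ) ^ 2 * ‖g n‖ ^ 2) →
      discFT g (Real.pi / 2) = 0 → discFT g (-(Real.pi / 2)) = 0 →
      ∀ n : ℤ, ‖alProp g t n‖ ≤
        C * t ^ (-(1 : ℝ) / 2) * Real.sqrt (∑' n : ℤ, (n : ℝ) ^ 2 * ‖g n‖ ^ 2) := by
  refine ⟨64000*3, by norm_num, fun t ht g hg hp hm n => ?_⟩
  have hpi := Real.pi_pos
  have ht0 : 0 < t := by linarith
  have hgs := aux_summable g hg
  set τ : ℝ := t ^ ((1:ℝ)/3) with hτdef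
  have hτ : 1 ≤ τ := Real.one_le_rpow ht (by norm_num)
  have hτ3 : τ^3 = t := by
    rw [hτdef, ← Real.rpow_natCast, ← Real.rpow_mul ht0.le]; norm_num
  have hττ : τ*√τ = √t := by
    rw [← hτ3, show τ^3 = τ^2*τ by ring, Real.sqrt_mul (by positivity), Real.sqrt_sq (by linarith)]
  have htt : t ^ (-(1:ℝ)/2) = 1/√t := by
    rw [neg_div, Real.rpow_neg ht0.le, Real.sqrt_eq_rpow, one_div, one_div]
  have hc0 : (Real.sqrt (2 * Real.pi) : ℂ)⁻¹ ≠ 0 := by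
    apply inv_ne_zero
    have : √(2*Real.pi) ≠ 0 := by positivity
    exact_mod_cast this
  have hterm : ∀ (k : ℤ) (ξ : ℝ), ‖g k * Complex.exp (Complex.I * (k : ℂ) * (ξ : ℂ))‖ = ‖g k‖ := by
    intro k ξ
    rw [norm_mul, show Complex.I * (k : ℂ) * (ξ : ℂ) = ((k*ξ : ℝ) : ℂ) * Complex.I by
      push_cast; ring, Complex.norm_exp_ofReal_mul_I, mul_one]
  have hsum : ∀ ξ : ℝ, HasSum (fun k : ℤ => g k * Complex.exp (Complex.I * (k : ℂ) * (ξ : ℂ)))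
      (∑' k : ℤ, g k * Complex.exp (Complex.I * (k : ℂ) * (ξ : ℂ))) := fun ξ =>
    (Summable.of_norm (by simpa only [hterm] using hgs)).hasSum
  have hb1 : Filter.Tendsto (fun s : Finset ℤ =>
      ∑ k ∈ s, g k * Complex.exp (Complex.I * (k:ℂ) * ((Real.pi/2 : ℝ):ℂ))) Filter.atTop (nhds 0) := by
    have := hsum (Real.pi/2)
    rwa [(mul_eq_zero.1 hp).resolve_left hc0] at this
  have hb2 : Filter.Tendsto (fun s : Finset ℤ =>
      ∑ k ∈ s, g k * Complex.exp (Complex.I * (k:ℂ) * ((-(Real.pi/2) : ℝ):ℂ)))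
      Filter.atTop (nhds 0) := by
    have := hsum (-(Real.pi/2))
    rwa [(mul_eq_zero.1 hm).resolve_left hc0] at this
  set J : ℂ := ∫ ξ in (-Real.pi)..Real.pi,
      Complex.exp (((2 * t * Real.cos ξ : ℝ) : ℂ) * Complex.I) *
        (∑' k : ℤ, g k * Complex.exp (Complex.I * (k : ℂ) * (ξ : ℂ))) *
        Complex.exp (-(Complex.I * (n : ℂ) * (ξ : ℂ))) with hJ
  have hal : alProp g t n = (Real.sqrt (2 * Real.pi) : ℂ)⁻¹ * ((Real.sqrt (2 * Real.pi) : ℂ)⁻¹ * J) := by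
    rw [hJ, ← intervalIntegral.integral_const_mul (Real.sqrt (2 * Real.pi) : ℂ)⁻¹, alProp]
    congr 1; refine intervalIntegral.integral_congr fun ξ _ => ?_
    simp only [discFT]; ring
  have hn1 : ∀ m : ℤ, ∀ ξ : ℝ, ‖Complex.exp (-(Complex.I * (m : ℂ) * (ξ : ℂ)))‖ = 1 := by
    intro m ξ
    rw [show -(Complex.I * (m : ℂ) * (ξ : ℂ)) = ((-(m*ξ) : ℝ) : ℂ) * Complex.I by
      push_cast; ring, Complex.norm_exp_ofReal_mul_I]
  have hlim : Filter.Tendsto (fun s : Finset ℤ => ∫ ξ in (-Real.pi)..Real.pi,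
      Complex.exp (((2 * t * Real.cos ξ : ℝ) : ℂ) * Complex.I) *
        (∑ k ∈ s, g k * Complex.exp (Complex.I * (k : ℂ) * (ξ : ℂ))) *
        Complex.exp (-(Complex.I * (n : ℂ) * (ξ : ℂ)))) Filter.atTop (nhds J) := by
    refine intervalIntegral.tendsto_integral_filter_of_dominated_convergence
      (fun _ => ∑' k, ‖g k‖) ?_ ?_ ?_ ?_
    · refine Filter.Eventually.of_forall fun s => Continuous.aestronglyMeasurable (by fun_prop)
    · refine Filter.Eventually.of_forall fun s => Filter.Eventually.of_forall fun ξ _ => ?_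
      rw [norm_mul, norm_mul, hn1, Complex.norm_exp_ofReal_mul_I, one_mul, mul_one]
      refine (norm_sum_le _ _).trans ?_
      simp only [hterm]
      exact hgs.sum_le_tsum s (fun _ _ => norm_nonneg _)
    · exact intervalIntegrable_const
    · refine Filter.Eventually.of_forall fun ξ _ => ?_
      exact ((hsum ξ).const_mul _).mul_const _
  set S := ∑' n : ℤ, (n : ℝ) ^ 2 * ‖g n‖ ^ 2 with hS
  have hbound : ‖J‖ ≤ 64000/(τ*√τ)*√(2*Real.pi*S) +
      2 * (2 + Real.pi*(1+2*τ^3)) * (‖(0:ℂ)‖ + ‖(0:ℂ)‖) := by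
    refine le_of_tendsto_of_tendsto hlim.norm
      (((hb1.norm.add hb2.norm).const_mul (2 * (2 + Real.pi*(1+2*τ^3)))).const_add
        (64000/(τ*√τ)*√(2*Real.pi*S))) (Filter.Eventually.of_forall fun s => ?_)
    have := aux_trig τ n hτ g s
    rw [hτ3] at this
    simp only [hτ3]
    refine this.trans ?_
    gcongr
    exact hg.sum_le_tsum s (fun _ _ => by positivity)
  rw [norm_zero, add_zero, mul_zero, add_zero, hττ, Real.sqrt_mul (by positivity)] at hbound
  have hsq : √(2*Real.pi) ≤ 3 := by
    rw [Real.sqrt_le_left (by norm_num)]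
    linarith [Real.pi_lt_d2]
  have hinv : ‖(Real.sqrt (2 * Real.pi) : ℂ)⁻¹‖ ≤ 1 := by
    rw [norm_inv, Complex.norm_real, Real.norm_eq_abs, abs_of_nonneg (Real.sqrt_nonneg _)]
    apply inv_le_one_of_one_le₀
    rw [Real.one_le_sqrt]
    linarith [Real.pi_gt_three]
  rw [hal, norm_mul, norm_mul, htt]
  calc _ ≤ 1 * (1 * ‖J‖) := by gcongr
    _ = ‖J‖ := by ring
    _ ≤ 64000/√t*(√(2*Real.pi)*√S) := hbound
    _ ≤ 64000/√t*(3*√S) := by gcongr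
    _ = _ := by ring
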